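/- Let Ξ = [v_1 ⋯ v_n] be a matrix of direction vectors v_k ∈ ℤ^d ∖ {0} with n ≥ d and Ξ_d := [v_1 ⋯ v_d] nonsingular. Then the integer translates of the box spline M_Ξ form a partition of unity: for every x ∈ ℝ^d, the family (M_Ξ(x − i))_{i ∈ ℤ^d} has only finitely many non-zero terms and Σ_{i ∈ ℤ^d} M_Ξ(x − i) = 1. -/

import Mathlib

open MeasureTheory

open Classical in
/-- The box spline on `d` columns: value `1/|det A|` on `A [0,1)^d`, zero elsewhere. -/
noncomputable def boxSplineBase (d : ℕ) (A : Matrix (Fin d) (Fin d) ℝ)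
    (x : Fin d → ℝ) : ℝ :=
  if ∃ u : Fin d → ℝ, (∀ i, 0 ≤ u i ∧ u i < 1) ∧ A.mulVec u = x then |A.det|⁻¹ else 0

/-- The box spline `M_Ξ` associated with direction vectors `v 0, …, v (n-1)` (columns of `Ξ`),
defined by the recursive convolution formula. Junk value `0` when `n < d`. -/
noncomputable def boxSpline (d : ℕ) : (n : ℕ) → (Fin n → Fin d → ℝ) → (Fin d → ℝ) → ℝ
  | n, v, x =>
    if h : n = d then
      boxSplineBase d (Matrix.of fun i j => v (Fin.cast h.symm j) i) x
    else if hle : n ≤ d then 0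
    else
      ∫ t in (0:ℝ)..1,
        boxSpline d (n - 1) (fun k => v (Fin.castLE (Nat.sub_le n 1) k))
          (fun i => x i - t * v ⟨n - 1, Nat.sub_lt (by omega) one_pos⟩ i)
  termination_by n => n
  decreasing_by omega

/-- The real matrix of columns obtained from integer direction vectors. -/
def intCols (d n : ℕ) (v : Fin n → Fin d → ℤ) : Fin n → Fin d → ℝ :=
  fun k i => (v k i : ℝ)

/-- The square matrix `Ξ_d` formed by the first `d` columns. -/
def leadMat (d n : ℕ) (hdn : d ≤ n) (w : Fin n → Fin d → ℝ) :
    Matrix (Fin d) (Fin d) ℝ :=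
  Matrix.of fun i j => w (Fin.castLE hdn j) i

/-- The linear map `t ↦ Ξ t = ∑ k, t k • v k`. -/
def xiVec (d n : ℕ) (w : Fin n → Fin d → ℝ) (t : Fin n → ℝ) : Fin d → ℝ :=
  fun i => ∑ k, t k * w k i

/-- A bounded measurable function of bounded support whose integer translates sum to `1`. -/
structure IsTranslatePartition {d : ℕ} (M : (Fin d → ℝ) → ℝ) : Prop where
  measurable : Measurable M
  bounded : ∃ C, ∀ x, |M x| ≤ C
  bounded_support : ∃ R, ∀ x, M x ≠ 0 → ∀ j, |x j| ≤ R
  finsum_eq_one : ∀ x : Fin d → ℝ, ∑ᶠ i : Fin d → ℤ, M (fun j => x j - (i j : ℝ)) = 1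

theorem finite_int_near {d : ℕ} (x : Fin d → ℝ) (R : ℝ) :
    {i : Fin d → ℤ | ∀ j, |x j - (i j : ℝ)| ≤ R}.Finite := by
  refine (Set.finite_Icc (fun j => ⌊x j - R⌋) (fun j => ⌈x j + R⌉)).subset fun i hi => ?_
  refine ⟨fun j => ?_, fun j => ?_⟩ <;> have h := abs_le.1 (hi j)
  · exact Int.cast_le.1 ((Int.floor_le (x j - R)).trans (by linarith))
  · exact Int.cast_le.1 (le_trans (by linarith) (Int.le_ceil (x j + R)))

theorem IsTranslatePartition.finite_support {d : ℕ} {M : (Fin d → ℝ) → ℝ}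
    (hM : IsTranslatePartition M) (x : Fin d → ℝ) :
    {i : Fin d → ℤ | M (fun j => x j - (i j : ℝ)) ≠ 0}.Finite := by
  obtain ⟨R, hR⟩ := hM.bounded_support
  exact (finite_int_near x R).subset fun i hi => hR _ hi

/-- Averaging along a segment preserves translate partitions. -/
theorem IsTranslatePartition.average {d : ℕ} {M : (Fin d → ℝ) → ℝ}
    (hM : IsTranslatePartition M) (w : Fin d → ℝ) :
    IsTranslatePartition fun x => ∫ t in (0 : ℝ)..1, M (fun i => x i - t * w i) := by
  obtain ⟨C, hC⟩ := hM.bounded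
  obtain ⟨R, hR⟩ := hM.bounded_support
  have near {x : Fin d → ℝ} {t : ℝ} (ht0 : 0 ≤ t) (ht1 : t ≤ 1)
      (h : M (fun i => x i - t * w i) ≠ 0) (j : Fin d) : |x j| ≤ R + ∑ k, |w k| := by
    have h1 := hR _ h j
    have h2 : |t * w j| ≤ |w j| := by
      rw [abs_mul, abs_of_nonneg ht0]
      exact mul_le_of_le_one_left (abs_nonneg _) ht1
    have h3 : |w j| ≤ ∑ k, |w k| :=
      Finset.single_le_sum (f := fun k => |w k|) (fun k _ => abs_nonneg _) (Finset.mem_univ j)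
    have h4 := abs_sub_abs_le_abs_sub (x j) (t * w j)
    linarith
  have support (x : Fin d → ℝ)
      (h : ∫ t in (0 : ℝ)..1, M (fun i => x i - t * w i) ≠ 0) (j : Fin d) :
      |x j| ≤ R + ∑ k, |w k| := by
    by_contra hj
    refine h (intervalIntegral.integral_zero_ae (.of_forall fun t ht => ?_))
    rw [Set.uIoc_of_le zero_le_one] at ht
    by_contra h0
    exact hj (near ht.1.le ht.2 h0 j)
  refine ⟨?_, ⟨C, fun x => ?_⟩, ⟨_, support⟩, fun x => ?_⟩
  · simp only [intervalIntegral.integral_of_le zero_le_one]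
    refine (StronglyMeasurable.integral_prod_right ?_).measurable
    refine (hM.measurable.comp ?_).stronglyMeasurable
    fun_prop
  · simpa using intervalIntegral.norm_integral_le_of_norm_le_const (a := (0 : ℝ)) (b := 1)
      (f := fun t => M (fun i => x i - t * w i)) (C := C) fun t _ => hC _
  · have hfin := finite_int_near x (R + ∑ k, |w k|)
    rw [finsum_eq_sum_of_support_subset (s := hfin.toFinset) _ fun i hi => by
      simpa using support _ hi, ← intervalIntegral.integral_finsetSum]
    · have : ∀ t ∈ Set.uIcc (0 : ℝ) 1,
          ∑ i ∈ hfin.toFinset, M (fun j => x j - (i j : ℝ) - t * w j) = 1 := by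
        intro t ht
        rw [Set.uIcc_of_le zero_le_one] at ht
        rw [← finsum_eq_sum_of_support_subset _ fun i hi => by
          simpa using near (x := fun j => x j - (i j : ℝ)) ht.1 ht.2 hi,
          ← hM.finsum_eq_one fun j => x j - t * w j]
        simp only [sub_right_comm]
      rw [intervalIntegral.integral_congr this]
      simp
    · intro i _
      rw [intervalIntegrable_iff]
      refine Measure.integrableOn_of_bounded (M := C) (by simp) ?_ (.of_forall fun t => hC _)
      refine (hM.measurable.comp ?_).aestronglyMeasurable
      fun_prop

theorem mulVec_mem_iff_inv {d : ℕ} {A : Matrix (Fin d) (Fin d) ℝ} (hA : A.det ≠ 0)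
    (x : Fin d → ℝ) :
    (∃ u : Fin d → ℝ, (∀ i, 0 ≤ u i ∧ u i < 1) ∧ A.mulVec u = x) ↔
      ∀ i, 0 ≤ (A⁻¹.mulVec x) i ∧ (A⁻¹.mulVec x) i < 1 := by
  have hu : IsUnit A.det := hA.isUnit
  constructor
  · rintro ⟨u, hu', rfl⟩
    simpa [Matrix.mulVec_mulVec, Matrix.nonsing_inv_mul _ hu] using hu'
  · exact fun h => ⟨_, h, by simp [Matrix.mulVec_mulVec, Matrix.mul_nonsing_inv _ hu]⟩

theorem card_quotient_range_toLin' {d : ℕ} (A : Matrix (Fin d) (Fin d) ℤ) (hA : A.det ≠ 0) :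
    Nat.card ((Fin d → ℤ) ⧸ LinearMap.range (Matrix.toLin' A)) = A.det.natAbs := by
  have hinj : Function.Injective (Matrix.toLin' A) := Matrix.mulVec_injective_of_det_ne_zero hA
  rw [← Submodule.natAbs_det_equiv _ (LinearEquiv.ofInjective _ hinj), ← LinearMap.det_toLin' A]
  rfl

/-- Each coset of `Aℤ^d` in `ℤ^d` contains exactly one `i` with `x - i ∈ A[0,1)^d`. -/
theorem card_int_translates {d : ℕ} (A : Matrix (Fin d) (Fin d) ℤ) (hA : A.det ≠ 0)
    (x : Fin d → ℝ) :
    Set.ncard {i : Fin d → ℤ |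
      ∀ k, 0 ≤ ((A.map (Int.cast : ℤ → ℝ))⁻¹.mulVec fun j => x j - (i j : ℝ)) k ∧
        ((A.map (Int.cast : ℤ → ℝ))⁻¹.mulVec fun j => x j - (i j : ℝ)) k < 1} =
      A.det.natAbs := by
  rw [← card_quotient_range_toLin' A hA, ← Nat.card_coe_set_eq]
  set B : Matrix (Fin d) (Fin d) ℝ := A.map (Int.cast : ℤ → ℝ) with hB
  have hdet : IsUnit B.det := by
    have : B.det = (A.det : ℝ) := (Int.cast_det A).symm
    rw [this, isUnit_iff_ne_zero]
    exact_mod_cast hA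
  have shift (i m : Fin d → ℤ) :
      (B⁻¹.mulVec fun j => x j - ((i + A.mulVec m) j : ℝ)) =
        (B⁻¹.mulVec fun j => x j - (i j : ℝ)) - fun j => (m j : ℝ) := by
    have : (fun j => x j - (((i + A.mulVec m) j : ℤ) : ℝ)) =
        (fun j => x j - (i j : ℝ)) - B.mulVec fun j => (m j : ℝ) := by
      ext j
      simp [Matrix.mulVec, dotProduct, hB]
      ring
    rw [this, Matrix.mulVec_sub, Matrix.mulVec_mulVec, Matrix.nonsing_inv_mul _ hdet,
      Matrix.one_mulVec]
  refine Nat.card_eq_of_bijective (fun i => Submodule.Quotient.mk i.1) ⟨?_, fun q => ?_⟩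
  · rintro ⟨i, hi⟩ ⟨i', hi'⟩ h
    obtain ⟨m, hm⟩ := (Submodule.Quotient.eq _).1 h.symm
    obtain rfl : i' = i + A.mulVec m := by
      rw [← Matrix.toLin'_apply, hm]; abel
    have hm0 : m = 0 := by
      ext k
      have h1 := hi k
      have h2 := hi' k
      rw [shift, Pi.sub_apply] at h2
      have h3 : (m k : ℝ) < 1 := by linarith
      have h4 : (-1 : ℝ) < m k := by linarith
      have h3' : m k < 1 := by exact_mod_cast h3
      have h4' : -1 < m k := by exact_mod_cast h4
      simp only [Pi.zero_apply]
      omega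
    simp [hm0]
  · obtain ⟨i, rfl⟩ := Submodule.Quotient.mk_surjective _ q
    refine ⟨⟨i + A.mulVec fun k => ⌊(B⁻¹.mulVec fun j => x j - (i j : ℝ)) k⌋, fun k => ?_⟩, ?_⟩
    · rw [shift, Pi.sub_apply]
      exact ⟨Int.fract_nonneg _, Int.fract_lt_one _⟩
    · exact (Submodule.Quotient.eq _).2 ⟨fun k => ⌊(B⁻¹.mulVec fun j => x j - (i j : ℝ)) k⌋, by simp⟩

theorem isTranslatePartition_boxSplineBase {d : ℕ} (A : Matrix (Fin d) (Fin d) ℤ)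
    (hA : A.det ≠ 0) : IsTranslatePartition (boxSplineBase d (A.map (Int.cast : ℤ → ℝ))) := by
  have hcard := card_int_translates A hA
  set B : Matrix (Fin d) (Fin d) ℝ := A.map (Int.cast : ℤ → ℝ)
  have hdet : B.det = (A.det : ℝ) := (Int.cast_det A).symm
  have hB : B.det ≠ 0 := by rw [hdet]; exact_mod_cast hA
  refine ⟨?_, ⟨|B.det|⁻¹, fun x => ?_⟩, ⟨∑ j, ∑ k, |B j k|, fun x hx j => ?_⟩, fun x => ?_⟩
  · unfold boxSplineBase
    simp only [mulVec_mem_iff_inv hB]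
    refine Measurable.ite ?_ measurable_const measurable_const
    have hm (i : Fin d) : Measurable fun x : Fin d → ℝ => B⁻¹.mulVec x i :=
      ((continuous_apply i).comp
        (continuous_const.matrix_mulVec continuous_id)).measurable
    simp only [Set.ofPred_forall, Set.ofPred_and]
    exact .iInter fun i => (measurableSet_le measurable_const (hm i)).inter
      (measurableSet_lt (hm i) measurable_const)
  · unfold boxSplineBase
    split_ifs <;> simp
  · classical
    unfold boxSplineBase at hx
    obtain ⟨⟨u, hu, rfl⟩, -⟩ := ite_ne_right_iff.1 hx
    calc
      |B.mulVec u j| ≤ ∑ k, |B j k * u k| := by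
        rw [Matrix.mulVec, dotProduct]
        exact Finset.abs_sum_le_sum_abs _ _
      _ ≤ ∑ k, |B j k| := Finset.sum_le_sum fun k _ => by
        rw [abs_mul, abs_of_nonneg (hu k).1]
        exact mul_le_of_le_one_right (abs_nonneg _) (hu k).2.le
      _ ≤ _ := Finset.single_le_sum (f := fun j => ∑ k, |B j k|)
        (fun j _ => Finset.sum_nonneg fun k _ => abs_nonneg _) (Finset.mem_univ j)
  · unfold boxSplineBase
    simp only [mulVec_mem_iff_inv hB]
    specialize hcard x
    have hfin : {i : Fin d → ℤ | ∀ k, 0 ≤ (B⁻¹.mulVec fun j => x j - (i j : ℝ)) k ∧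
        (B⁻¹.mulVec fun j => x j - (i j : ℝ)) k < 1}.Finite :=
      Set.finite_of_ncard_ne_zero (by rw [hcard]; exact Int.natAbs_ne_zero.2 hA)
    rw [finsum_eq_sum_of_support_subset (s := hfin.toFinset) _ fun i hi => by
      simpa using (ite_ne_right_iff.1 hi).1]
    rw [Finset.sum_congr rfl fun i hi => if_pos (by simpa using hi), Finset.sum_const,
      ← Set.ncard_eq_toFinset_card _ hfin, nsmul_eq_mul, hcard, hdet, Nat.cast_natAbs, Int.cast_abs, mul_inv_cancel₀]
    exact abs_ne_zero.2 (by exact_mod_cast hA)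

theorem boxSpline_self (d : ℕ) (v : Fin d → Fin d → ℝ) :
    boxSpline d d v = boxSplineBase d (Matrix.of fun i j => v j i) := by
  ext x
  rw [boxSpline]
  simp

theorem boxSpline_succ {d n : ℕ} (hdn : d ≤ n) (v : Fin (n + 1) → Fin d → ℝ) :
    boxSpline d (n + 1) v = fun x => ∫ t in (0 : ℝ)..1,
      boxSpline d n (fun k => v k.castSucc) (fun i => x i - t * v (Fin.last n) i) := by
  ext x
  rw [boxSpline, dif_neg (by omega), dif_neg (by omega)]
  rfl

theorem isTranslatePartition_boxSpline {d n : ℕ} (hdn : d ≤ n) (v : Fin n → Fin d → ℤ)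
    (hns : (leadMat d n hdn (intCols d n v)).det ≠ 0) :
    IsTranslatePartition (boxSpline d n (intCols d n v)) := by
  induction n, hdn using Nat.le_induction with
  | base =>
    rw [boxSpline_self]
    refine isTranslatePartition_boxSplineBase (Matrix.of fun i j => v j i) fun h => hns ?_
    have := congrArg (Int.cast : ℤ → ℝ) h
    rwa [Int.cast_det, Int.cast_zero] at this
  | succ n hdn ih =>
    rw [boxSpline_succ hdn]
    exact (ih (fun k => v k.castSucc) hns).average _

/-- The integer translates of the box spline form a partition of unity:
for each `x`, only finitely many translates are non-zero at `x`, and they sum to `1`. -/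
theorem boxSpline_partition_of_unity (d n : ℕ) (hdn : d ≤ n)
    (v : Fin n → Fin d → ℤ) (hv : ∀ k, v k ≠ 0)
    (hns : (leadMat d n hdn (intCols d n v)).det ≠ 0)
    (x : Fin d → ℝ) :
    {i : Fin d → ℤ |
        boxSpline d n (intCols d n v) (fun j => x j - (i j : ℝ)) ≠ 0}.Finite ∧
      ∑ᶠ i : Fin d → ℤ,
        boxSpline d n (intCols d n v) (fun j => x j - (i j : ℝ)) = 1 := by
  have h := isTranslatePartition_boxSpline hdn v hns
  exact ⟨h.finite_support x, h.finsum_eq_one x⟩
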